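/- A lightcone framed curve (γ,ℓ⁺,ℓ⁻) : I → ℝ³₁ × Δ₄ with lightcone curvature (κ₁,κ₂,κ₃,α,β) is an (ℓ̃⁻,ℓ̄⁺)-Bertrand lightcone framed curve if and only if there exist smooth functions λ, k : I → ℝ with λ ≢ 0 such that k(t)(α(t)+β(t)) − α(t) + β(t) − λ(t)(κ₁(t)−κ₂(t)+κ₃(t)) = 0 for all t ∈ I. -/

import Mathlib

open Matrix

noncomputable section

/-- The Minkowski pseudo-scalar product on `ℝ³`:
`⟨x,y⟩ = −x₁y₁ + x₂y₂ + x₃y₃`. -/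
def mdot (x y : Fin 3 → ℝ) : ℝ := -(x 0 * y 0) + x 1 * y 1 + x 2 * y 2

/-- The pseudo vector product `x ∧ y` on Minkowski `ℝ³`, i.e. the determinant of the
matrix with rows `(−e₁, e₂, e₃)`, `x`, `y`. -/
def mcross (x y : Fin 3 → ℝ) : Fin 3 → ℝ :=
  ![-(x 1 * y 2 - x 2 * y 1), x 2 * y 0 - x 0 * y 2, x 0 * y 1 - x 1 * y 0]

/-- The (punctured) lightcone `LC* = {x ≠ 0 : ⟨x,x⟩ = 0}`. -/
def LCstar (x : Fin 3 → ℝ) : Prop := x ≠ 0 ∧ mdot x x = 0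

/-- Membership in `Δ₄ = {(v,w) ∈ LC* × LC* : ⟨v,w⟩ = −2}`. -/
def MemDelta4 (v w : Fin 3 → ℝ) : Prop := LCstar v ∧ LCstar w ∧ mdot v w = -2

/-- `n(t) = −(1/2) ℓ⁺(t) ∧ ℓ⁻(t)`. -/
def lcn (lp lm : ℝ → Fin 3 → ℝ) : ℝ → Fin 3 → ℝ :=
  fun t => (-(1/2) : ℝ) • mcross (lp t) (lm t)

/-- Smoothness (on `I`) of a real valued function. -/
def Smooth1 (I : Set ℝ) (f : ℝ → ℝ) : Prop := ContDiffOn ℝ (⊤ : ℕ∞) f I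

/-- Smoothness (on `I`) of an `ℝ³`-valued function. -/
def Smooth3 (I : Set ℝ) (f : ℝ → Fin 3 → ℝ) : Prop := ContDiffOn ℝ (⊤ : ℕ∞) f I

/-- `λ ≢ 0` : the set where `λ` is non-zero is dense in `I`. -/
def NotIdentZero (I : Set ℝ) (f : ℝ → ℝ) : Prop :=
  I ⊆ closure {t | t ∈ I ∧ f t ≠ 0}

/-- A lightcone framed curve `(γ, ℓ⁺, ℓ⁻) : I → ℝ³₁ × Δ₄`. -/
structure IsLightconeFramedCurve (I : Set ℝ) (γ lp lm : ℝ → Fin 3 → ℝ) : Prop where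
  smooth_base : Smooth3 I γ
  smooth_lp : Smooth3 I lp
  smooth_lm : Smooth3 I lm
  delta4 : ∀ t ∈ I, MemDelta4 (lp t) (lm t)
  exists_coeffs : ∃ α β : ℝ → ℝ, Smooth1 I α ∧ Smooth1 I β ∧
    ∀ t ∈ I, deriv γ t = α t • lp t + β t • lm t

/-- `(κ₁, κ₂, κ₃, α, β)` is the lightcone curvature of the lightcone framed curve
`(γ, ℓ⁺, ℓ⁻)`. -/
structure HasLightconeCurvature (I : Set ℝ) (γ lp lm : ℝ → Fin 3 → ℝ)
    (κ₁ κ₂ κ₃ α β : ℝ → ℝ) : Prop where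
  smooth_κ₁ : Smooth1 I κ₁
  smooth_κ₂ : Smooth1 I κ₂
  smooth_κ₃ : Smooth1 I κ₃
  smooth_α : Smooth1 I α
  smooth_β : Smooth1 I β
  deriv_lp : ∀ t ∈ I, deriv lp t = κ₁ t • lp t + (2 * κ₃ t) • lcn lp lm t
  deriv_lm : ∀ t ∈ I, deriv lm t = (-κ₁ t) • lm t + (2 * κ₂ t) • lcn lp lm t
  deriv_n : ∀ t ∈ I, deriv (lcn lp lm) t = κ₂ t • lp t + κ₃ t • lm t
  deriv_base : ∀ t ∈ I, deriv γ t = α t • lp t + β t • lm t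

/-- The vector field `ℓ⁺` built from a lightcone frame. -/
def fieldLp (lp lm : ℝ → Fin 3 → ℝ) : ℝ → Fin 3 → ℝ := fun t => lp t
/-- The vector field `ℓ⁻` built from a lightcone frame. -/
def fieldLm (lp lm : ℝ → Fin 3 → ℝ) : ℝ → Fin 3 → ℝ := fun t => lm t
/-- `nᵀ = (ℓ⁺ + ℓ⁻)/2`. -/
def fieldNT (lp lm : ℝ → Fin 3 → ℝ) : ℝ → Fin 3 → ℝ := fun t => (1/2 : ℝ) • (lp t + lm t)
/-- `nˢ = (ℓ⁺ − ℓ⁻)/2`. -/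
def fieldNS (lp lm : ℝ → Fin 3 → ℝ) : ℝ → Fin 3 → ℝ := fun t => (1/2 : ℝ) • (lp t - lm t)
/-- `n = −(1/2) ℓ⁺ ∧ ℓ⁻`. -/
def fieldN (lp lm : ℝ → Fin 3 → ℝ) : ℝ → Fin 3 → ℝ := lcn lp lm
/-- `ℓ̃⁺ = nᵀ + n`. -/
def fieldLtp (lp lm : ℝ → Fin 3 → ℝ) : ℝ → Fin 3 → ℝ :=
  fun t => fieldNT lp lm t + fieldN lp lm t
/-- `ℓ̃⁻ = nᵀ − n`. -/
def fieldLtm (lp lm : ℝ → Fin 3 → ℝ) : ℝ → Fin 3 → ℝ :=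
  fun t => fieldNT lp lm t - fieldN lp lm t

/-- `(γ,ℓ⁺,ℓ⁻)` and `(γ̄,ℓ̄⁺,ℓ̄⁻)` are `(v,w̄)`-mates. -/
def AreMates (I : Set ℝ)
    (v w : (ℝ → Fin 3 → ℝ) → (ℝ → Fin 3 → ℝ) → ℝ → Fin 3 → ℝ)
    (γ lp lm γ' lp' lm' : ℝ → Fin 3 → ℝ) : Prop :=
  IsLightconeFramedCurve I γ lp lm ∧ IsLightconeFramedCurve I γ' lp' lm' ∧
  ∃ lam : ℝ → ℝ, Smooth1 I lam ∧ NotIdentZero I lam ∧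
    (∀ t ∈ I, γ' t = γ t + lam t • v lp lm t) ∧
    (∀ t ∈ I, v lp lm t = w lp' lm' t)

/-- `(γ,ℓ⁺,ℓ⁻)` is a `(v,w̄)`-Bertrand lightcone framed curve. -/
def IsBertrand (I : Set ℝ)
    (v w : (ℝ → Fin 3 → ℝ) → (ℝ → Fin 3 → ℝ) → ℝ → Fin 3 → ℝ)
    (γ lp lm : ℝ → Fin 3 → ℝ) : Prop :=
  ∃ γ' lp' lm' : ℝ → Fin 3 → ℝ, AreMates I v w γ lp lm γ' lp' lm'

section MinkowskiAlgebra

lemma mdot_comm (x y : Fin 3 → ℝ) : mdot x y = mdot y x := by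
  simp only [mdot]; ring

lemma mdot_add_left (x y z : Fin 3 → ℝ) : mdot (x + y) z = mdot x z + mdot y z := by
  simp only [mdot, Pi.add_apply]; ring

lemma mdot_smul_left (a : ℝ) (x z : Fin 3 → ℝ) : mdot (a • x) z = a * mdot x z := by
  simp only [mdot, Pi.smul_apply, smul_eq_mul]; ring

lemma mdot_add_right (x y z : Fin 3 → ℝ) : mdot x (y + z) = mdot x y + mdot x z := by
  simp only [mdot, Pi.add_apply]; ring

lemma mdot_smul_right (a : ℝ) (x z : Fin 3 → ℝ) : mdot x (a • z) = a * mdot x z := by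
  simp only [mdot, Pi.smul_apply, smul_eq_mul]; ring

lemma mdot_mcross_left (x y : Fin 3 → ℝ) : mdot x (mcross x y) = 0 := by
  simp [mdot, mcross]; ring

lemma mdot_mcross_right (x y : Fin 3 → ℝ) : mdot y (mcross x y) = 0 := by
  simp [mdot, mcross]; ring

lemma mdot_mcross_self (x y : Fin 3 → ℝ) :
    mdot (mcross x y) (mcross x y) = mdot x y ^ 2 - mdot x x * mdot y y := by
  simp [mdot, mcross]; ring

/-- The pseudo-scalar product in the coordinates of a lightcone frame. -/
lemma MemDelta4.mdot_frame {x y : Fin 3 → ℝ} (h : MemDelta4 x y) (a b c a' b' c' : ℝ) :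
    mdot (a • x + b • y + c • ((-(1/2) : ℝ) • mcross x y))
      (a' • x + b' • y + c' • ((-(1/2) : ℝ) • mcross x y)) =
      -2 * (a * b' + b * a') + c * c' := by
  obtain ⟨⟨-, hx⟩, ⟨-, hy⟩, hxy⟩ := h
  have hyx : mdot y x = -2 := by rw [mdot_comm, hxy]
  have h1 := mdot_mcross_left x y
  have h2 := mdot_mcross_right x y
  have h3 : mdot (mcross x y) x = 0 := by rw [mdot_comm, h1]
  have h4 : mdot (mcross x y) y = 0 := by rw [mdot_comm, h2]
  have h5 : mdot (mcross x y) (mcross x y) = 4 := by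
    rw [mdot_mcross_self, hx, hy, hxy]; norm_num
  simp only [mdot_add_left, mdot_add_right, mdot_smul_left, mdot_smul_right,
    hx, hy, hxy, hyx, h1, h2, h3, h4, h5]
  ring

lemma memDelta4_of_mdot {x y : Fin 3 → ℝ} (hx : mdot x x = 0) (hy : mdot y y = 0)
    (hxy : mdot x y = -2) : MemDelta4 x y := by
  refine ⟨⟨?_, hx⟩, ⟨?_, hy⟩, hxy⟩
  · rintro rfl
    simp [mdot] at hxy
  · rintro rfl
    simp [mdot] at hxy

end MinkowskiAlgebra

lemma fieldLtm_eq (lp lm : ℝ → Fin 3 → ℝ) (t : ℝ) :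
    fieldLtm lp lm t = (1/2 : ℝ) • lp t + (1/2 : ℝ) • lm t + (-1 : ℝ) • lcn lp lm t := by
  simp only [fieldLtm, fieldNT, fieldN]
  module

/-- The null vectors `M` with `⟨ℓ̃⁻, M⟩ = −2`, parametrized by `c`:
`M = ℓ̃⁺ + 2c nˢ + c² ℓ̃⁻`. -/
def nullPartner (lp lm : ℝ → Fin 3 → ℝ) (c : ℝ → ℝ) : ℝ → Fin 3 → ℝ :=
  fun t => fieldLtp lp lm t + (2 * c t) • fieldNS lp lm t + c t ^ 2 • fieldLtm lp lm t

lemma nullPartner_eq (lp lm : ℝ → Fin 3 → ℝ) (c : ℝ → ℝ) (t : ℝ) :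
    nullPartner lp lm c t = (1/2 + c t + c t ^ 2 / 2) • lp t +
      (1/2 - c t + c t ^ 2 / 2) • lm t + (1 - c t ^ 2) • lcn lp lm t := by
  simp only [nullPartner, fieldLtp, fieldLtm, fieldNT, fieldN, fieldNS]
  module

lemma memDelta4_fieldLtm_nullPartner {lp lm : ℝ → Fin 3 → ℝ} {t : ℝ}
    (h : MemDelta4 (lp t) (lm t)) (c : ℝ → ℝ) :
    MemDelta4 (fieldLtm lp lm t) (nullPartner lp lm c t) := by
  apply memDelta4_of_mdot
  all_goals
    simp only [fieldLtm_eq, nullPartner_eq, lcn, h.mdot_frame]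
    ring

section Smoothness

variable {I : Set ℝ}

lemma Smooth3.lcn {lp lm : ℝ → Fin 3 → ℝ} (hp : Smooth3 I lp) (hm : Smooth3 I lm) :
    Smooth3 I (lcn lp lm) := by
  have p := contDiffOn_pi.1 hp
  have m := contDiffOn_pi.1 hm
  refine contDiffOn_pi.2 fun i => ?_
  have p0 := p 0
  have p1 := p 1
  have p2 := p 2
  have m0 := m 0
  have m1 := m 1
  have m2 := m 2
  fin_cases i <;> simp [_root_.lcn, mcross] <;> fun_prop

lemma Smooth3.fieldLtm {lp lm : ℝ → Fin 3 → ℝ} (hp : Smooth3 I lp) (hm : Smooth3 I lm) :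
    Smooth3 I (fieldLtm lp lm) := by
  have hn : ContDiffOn ℝ _ _ _ := hp.lcn hm
  unfold Smooth3 at *
  have h : _root_.fieldLtm lp lm = _ := funext (fieldLtm_eq lp lm)
  rw [h]
  fun_prop

lemma Smooth3.nullPartner {lp lm : ℝ → Fin 3 → ℝ} {c : ℝ → ℝ} (hp : Smooth3 I lp)
    (hm : Smooth3 I lm) (hc : Smooth1 I c) : Smooth3 I (nullPartner lp lm c) := by
  have hn : ContDiffOn ℝ _ _ _ := hp.lcn hm
  unfold Smooth3 Smooth1 at *
  have h : _root_.nullPartner lp lm c = _ := funext (nullPartner_eq lp lm c)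
  rw [h]
  fun_prop

lemma Smooth1.mdot {x y : ℝ → Fin 3 → ℝ} (hx : Smooth3 I x) (hy : Smooth3 I y) :
    Smooth1 I (fun t => mdot (x t) (y t)) := by
  have p := contDiffOn_pi.1 hx
  have m := contDiffOn_pi.1 hy
  have p0 := p 0
  have p1 := p 1
  have p2 := p 2
  have m0 := m 0
  have m1 := m 1
  have m2 := m 2
  unfold Smooth1 _root_.mdot
  fun_prop

lemma Smooth1.deriv {f : ℝ → ℝ} (hI : IsOpen I) (hf : Smooth1 I f) : Smooth1 I (deriv f) :=
  hf.deriv_of_isOpen hI (by norm_cast)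

lemma Smooth1.differentiableAt {f : ℝ → ℝ} (hI : IsOpen I) (hf : Smooth1 I f) {t : ℝ}
    (ht : t ∈ I) : DifferentiableAt ℝ f t :=
  (hf.contDiffAt (hI.mem_nhds ht)).differentiableAt (by simp)

lemma Smooth3.differentiableAt {f : ℝ → Fin 3 → ℝ} (hI : IsOpen I) (hf : Smooth3 I f) {t : ℝ}
    (ht : t ∈ I) : DifferentiableAt ℝ f t :=
  (hf.contDiffAt (hI.mem_nhds ht)).differentiableAt (by simp)

end Smoothness

/-- The derivative of `γ + λ ℓ̃⁻`, in the coordinates of the frame `(ℓ⁺, ℓ⁻, n)`. -/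
lemma deriv_base_add_smul_fieldLtm {I : Set ℝ} (hI : IsOpen I)
    {γ lp lm : ℝ → Fin 3 → ℝ} {κ₁ κ₂ κ₃ α β lam : ℝ → ℝ}
    (hF : IsLightconeFramedCurve I γ lp lm)
    (hC : HasLightconeCurvature I γ lp lm κ₁ κ₂ κ₃ α β) (hlam : Smooth1 I lam)
    {γ' : ℝ → Fin 3 → ℝ} (hγ' : ∀ t ∈ I, γ' t = γ t + lam t • fieldLtm lp lm t)
    {t : ℝ} (ht : t ∈ I) :
    deriv γ' t =
      (α t + deriv lam t / 2 + lam t * (κ₁ t / 2 - κ₂ t)) • lp t +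
      (β t + deriv lam t / 2 + lam t * (-κ₁ t / 2 - κ₃ t)) • lm t +
      (-deriv lam t + lam t * (κ₂ t + κ₃ t)) • lcn lp lm t := by
  have hp := (hF.smooth_lp.differentiableAt hI ht).hasDerivAt
  have hm := (hF.smooth_lm.differentiableAt hI ht).hasDerivAt
  have hn := ((hF.smooth_lp.lcn hF.smooth_lm).differentiableAt hI ht).hasDerivAt
  have hg := (hF.smooth_base.differentiableAt hI ht).hasDerivAt
  have hl := (hlam.differentiableAt hI ht).hasDerivAt
  have hL := ((hp.const_smul (1/2 : ℝ)).add (hm.const_smul (1/2 : ℝ))).add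
    (hn.const_smul (-1 : ℝ))
  have h := hg.add (hl.smul hL)
  have h' : HasDerivAt γ' _ t := h.congr_of_eventuallyEq (by
    filter_upwards [hI.mem_nhds ht] with s hs
    exact (hγ' s hs).trans (by rw [fieldLtm_eq]; rfl))
  rw [h'.deriv, hC.deriv_lp t ht, hC.deriv_lm t ht,
    hC.deriv_n t ht, hC.deriv_base t ht]
  simp only [Pi.add_apply, Pi.smul_apply]
  module

/-- `(ℓ̃⁻,ℓ̄⁺)`-Bertrand lightcone framed curves: existence condition. -/
theorem bertrand_ltm_lpbar
    (I : Set ℝ) (hIo : IsOpen I) (hIc : I.OrdConnected)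
    (γ lp lm : ℝ → Fin 3 → ℝ) (κ₁ κ₂ κ₃ α β : ℝ → ℝ)
    (hF : IsLightconeFramedCurve I γ lp lm)
    (hC : HasLightconeCurvature I γ lp lm κ₁ κ₂ κ₃ α β) :
    IsBertrand I fieldLtm fieldLp γ lp lm ↔
      ∃ lam k : ℝ → ℝ, Smooth1 I lam ∧ Smooth1 I k ∧ NotIdentZero I lam ∧
        ∀ t ∈ I, k t * (α t + β t) - α t + β t -
          lam t * (κ₁ t - κ₂ t + κ₃ t) = 0 := by
  constructor
  · rintro ⟨γ', lp', lm', -, hF', lam, hlam, hlam0, hγ', hv⟩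
    obtain ⟨a, b, -, -, hab⟩ := hF'.exists_coeffs
    have hp := hF.smooth_lp
    have hm := hF.smooth_lm
    have hS : Smooth3 I (fieldNS lp lm) := by
      unfold Smooth3 fieldNS at *
      fun_prop
    refine ⟨lam, fun t => (1/2) * mdot (lm' t) (fieldNS lp lm t), hlam, ?_, hlam0, ?_⟩
    · exact contDiffOn_const.mul (Smooth1.mdot hF'.smooth_lm hS)
    intro t ht
    have hΔ := hF.delta4 t ht
    have hd := deriv_base_add_smul_fieldLtm hIo hF hC hlam hγ' ht
    have hL : lp' t = _ := (hv t ht).symm.trans (fieldLtm_eq lp lm t)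
    have hS' : fieldNS lp lm t =
        (1/2 : ℝ) • lp t + (-1/2 : ℝ) • lm t + (0 : ℝ) • lcn lp lm t := by
      simp only [fieldNS]
      module
    have hLS : mdot (lp' t) (fieldNS lp lm t) = 0 := by
      rw [hL, hS', lcn, hΔ.mdot_frame]; ring
    have hΔ' := hF'.delta4 t ht
    have hML : mdot (lm' t) (lp' t) = -2 := by rw [mdot_comm]; exact hΔ'.2.2
    have e1 := congrArg (fun x => mdot x (lp' t)) (hab t ht)
    have e2 := congrArg (fun x => mdot x (fieldNS lp lm t)) (hab t ht)
    simp only [mdot_add_left, mdot_smul_left, hML, hLS, hΔ'.1.2] at e1 e2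
    rw [hd, hL, lcn, hΔ.mdot_frame] at e1
    rw [hd, hS', lcn, hΔ.mdot_frame, ← lcn, ← hS'] at e2
    linear_combination (-mdot (lm' t) (fieldNS lp lm t) / 2) * e1 - e2
  · rintro ⟨lam, k, hlam, hk, hlam0, h⟩
    have hp := hF.smooth_lp
    have hm := hF.smooth_lm
    have hγ' : Smooth3 I (fun t => γ t + lam t • fieldLtm lp lm t) :=
      hF.smooth_base.add (hlam.smul (hp.fieldLtm hm))
    refine ⟨fun t => γ t + lam t • fieldLtm lp lm t, fieldLtm lp lm, nullPartner lp lm k, hF,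
      ⟨hγ', hp.fieldLtm hm, hp.nullPartner hm hk,
        fun t ht => memDelta4_fieldLtm_nullPartner (hF.delta4 t ht) k,
        fun t => (α t + β t) / 2 * (1 - k t ^ 2) + deriv lam t - lam t * (κ₂ t + κ₃ t),
        fun t => (α t + β t) / 2, ?_, ?_, ?_⟩,
      lam, hlam, hlam0, fun _ _ => rfl, fun _ _ => rfl⟩
    · have hα := hC.smooth_α
      have hβ := hC.smooth_β
      have h2 := hC.smooth_κ₂
      have h3 := hC.smooth_κ₃
      have hd := hlam.deriv hIo
      unfold Smooth1 at *
      fun_prop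
    · have hα := hC.smooth_α
      have hβ := hC.smooth_β
      unfold Smooth1 at *
      fun_prop
    · intro t ht
      rw [deriv_base_add_smul_fieldLtm hIo hF hC hlam (fun _ _ => rfl) ht, fieldLtm_eq,
        nullPartner_eq]
      match_scalars
      · linear_combination (-1/2) * h t ht
      · linear_combination (1/2) * h t ht
      · ring
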